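/- arXiv:2505.02058 — 2 statements merged into one kernel-verified Lean document; each statement's English description precedes it below -/
import Mathlib

section
/- Let n ≥ 3, let 1 ≤ i < j ≤ n, and let 0 ≤ k ≤ n−2. Then the number of permutations of {1,…,n} with exactly k fixed points in which j lies in a 2-cycle and i precedes j satisfies 2(n−1)(n−2)·#{σ ∈ D_{n,k} : σ(j) ≠ j, σ(σ(j)) = j, and σ⁻¹(i) < σ⁻¹(j)} = d_{n−1,k+1}·(k+1)·(2k(n−i−1) + (n−2)(n−2−k)). -/
/-- Number of inversions of a permutation of `Fin n`: the number of pairs of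
positions `a < b` with `σ a > σ b`. -/
def inversions {n : ℕ} (σ : Equiv.Perm (Fin n)) : ℕ :=
  ((Finset.univ : Finset (Fin n × Fin n)).filter
    (fun p => p.1 < p.2 ∧ σ p.2 < σ p.1)).card

/-- The set of derangements (fixed-point-free permutations) of `Fin n`. -/
def derangeSet (n : ℕ) : Finset (Equiv.Perm (Fin n)) :=
  Finset.univ.filter (fun σ => ∀ x, σ x ≠ x)

/-- The number of derangements of `Fin n` (so `numDerange 0 = 1`). -/
def numDerange (n : ℕ) : ℕ := (derangeSet n).card

/-- The number of fixed points of a permutation of `Fin n`. -/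
def fixedPointCount {n : ℕ} (σ : Equiv.Perm (Fin n)) : ℕ :=
  (Finset.univ.filter (fun x => σ x = x)).card

/-- The set of permutations of `Fin n` with exactly `k` fixed points. -/
def permsWithFixed (n k : ℕ) : Finset (Equiv.Perm (Fin n)) :=
  Finset.univ.filter (fun σ => fixedPointCount σ = k)

/-- The number of permutations of `Fin n` with exactly `k` fixed points. -/
def numPermsWithFixed (n k : ℕ) : ℕ := (permsWithFixed n k).card

/-- The number of permutations of `Fin n` with exactly `k` fixed points that fix every element
of `S`. -/
def numFixing (n k : ℕ) (S : Finset (Fin n)) : ℕ :=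
  ((permsWithFixed n k).filter (fun τ => ∀ x ∈ S, τ x = x)).card

theorem mem_permsWithFixed {n k : ℕ} {σ : Equiv.Perm (Fin n)} :
    σ ∈ permsWithFixed n k ↔ fixedPointCount σ = k := by
  simp [permsWithFixed]

theorem fixedPointCount_conj {n : ℕ} (g σ : Equiv.Perm (Fin n)) :
    fixedPointCount (g * σ * g⁻¹) = fixedPointCount σ := by
  unfold fixedPointCount
  refine Finset.card_nbij' (fun x => g⁻¹ x) (fun x => g x) ?_ ?_ ?_ ?_
  · intro x hx
    rw [Finset.mem_coe, Finset.mem_filter] at hx ⊢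
    exact ⟨Finset.mem_univ _, g.injective (by simpa using hx.2)⟩
  · intro x hx
    rw [Finset.mem_coe, Finset.mem_filter] at hx ⊢
    exact ⟨Finset.mem_univ _, by simpa using hx.2⟩
  · intro x _
    simp
  · intro x _
    simp

theorem numFixing_le_conj {n : ℕ} (k : ℕ) {S T : Finset (Fin n)} (g : Equiv.Perm (Fin n))
    (h : ∀ x ∈ T, g⁻¹ x ∈ S) : numFixing n k S ≤ numFixing n k T := by
  unfold numFixing
  refine Finset.card_le_card_of_injOn (fun τ => g * τ * g⁻¹) ?_ ?_
  · intro τ hτ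
    simp only [Finset.coe_filter, Set.mem_ofPred_eq, mem_permsWithFixed] at hτ ⊢
    refine ⟨by rw [fixedPointCount_conj, hτ.1], fun x hx => ?_⟩
    rw [Equiv.Perm.mul_apply, Equiv.Perm.mul_apply, hτ.2 _ (h x hx)]
    simp
  · intro a _ b _ hab
    simpa using hab

theorem numFixing_insert_eq {n : ℕ} (k : ℕ) {S : Finset (Fin n)} {a b : Fin n}
    (ha : a ∉ S) (hb : b ∉ S) :
    numFixing n k (insert a S) = numFixing n k (insert b S) := by
  have key : ∀ a b : Fin n, a ∉ S → b ∉ S →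
      numFixing n k (insert a S) ≤ numFixing n k (insert b S) := by
    intro a b ha hb
    refine numFixing_le_conj k (Equiv.swap a b) fun x hx => ?_
    rw [Equiv.swap_inv]
    rcases Finset.mem_insert.1 hx with rfl | hx
    · simp
    · rw [Equiv.swap_apply_of_ne_of_ne (ne_of_mem_of_not_mem hx ha) (ne_of_mem_of_not_mem hx hb)]
      exact Finset.mem_insert_of_mem hx
  exact le_antisymm (key a b ha hb) (key b a hb ha)

/-- Double counting of pairs consisting of a permutation fixing `S` pointwise and a fixed point
of it outside `S`. -/
theorem card_compl_mul_numFixing_insert {n : ℕ} (k : ℕ) {S : Finset (Fin n)} {a : Fin n}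
    (ha : a ∉ S) :
    ((n : ℤ) - S.card) * numFixing n k (insert a S) = ((k : ℤ) - S.card) * numFixing n k S := by
  have h1 : ∑ x ∈ Sᶜ, (numFixing n k (insert x S) : ℤ)
      = ((n : ℤ) - S.card) * numFixing n k (insert a S) := by
    rw [Finset.sum_congr rfl (fun x hx => by
      rw [numFixing_insert_eq k (Finset.mem_compl.1 hx) ha]), Finset.sum_const, Finset.card_compl,
      Fintype.card_fin, nsmul_eq_mul, Nat.cast_sub (by simpa using Finset.card_le_univ S)]
  rw [← h1]
  have h2 := Finset.sum_card_bipartiteAbove_eq_sum_card_bipartiteBelow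
    (s := Sᶜ) (t := (permsWithFixed n k).filter (fun τ => ∀ x ∈ S, τ x = x))
    (fun x τ => τ x = x)
  have h3 : ∀ x, (Finset.bipartiteAbove (fun (x : Fin n) (τ : Equiv.Perm (Fin n)) => τ x = x)
      ((permsWithFixed n k).filter (fun τ => ∀ x ∈ S, τ x = x)) x).card
      = numFixing n k (insert x S) := by
    intro x
    unfold numFixing Finset.bipartiteAbove
    rw [Finset.filter_filter]
    congr 1
    ext τ
    simp only [Finset.mem_filter, Finset.forall_mem_insert]
    tauto
  have h4 : ∀ τ ∈ (permsWithFixed n k).filter (fun τ => ∀ x ∈ S, τ x = x),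
      ((Finset.bipartiteBelow (fun (x : Fin n) (τ : Equiv.Perm (Fin n)) => τ x = x) Sᶜ τ).card : ℤ)
        = (k : ℤ) - S.card := by
    intro τ hτ
    rw [Finset.mem_filter, mem_permsWithFixed] at hτ
    have hs : Finset.bipartiteBelow (fun (x : Fin n) (τ : Equiv.Perm (Fin n)) => τ x = x) Sᶜ τ
        = (Finset.univ.filter (fun x => τ x = x)) \ S := by
      ext x
      simp [Finset.bipartiteBelow, and_comm]
    have hsub : S ⊆ Finset.univ.filter (fun x => τ x = x) := fun x hx => by
      simpa using hτ.2 x hx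
    rw [hs, Finset.card_sdiff_of_subset hsub, Nat.cast_sub (Finset.card_le_card hsub)]
    have := hτ.1
    unfold fixedPointCount at this
    rw [this]
  simp only [h3] at h2
  rw [← Nat.cast_sum, h2, Nat.cast_sum, Finset.sum_congr rfl h4, Finset.sum_const, nsmul_eq_mul,
    mul_comm]
  rfl

theorem fixedPointCount_subtypePerm {n : ℕ} (j : Fin (n + 1)) (e : Fin n ≃ {x // x ≠ j})
    (ρ : Equiv.Perm (Fin n)) :
    fixedPointCount (Equiv.Perm.ofSubtype (e.permCongr ρ)) = fixedPointCount ρ + 1 := by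
  have hs : Finset.univ.filter (fun x => Equiv.Perm.ofSubtype (e.permCongr ρ) x = x)
      = insert j ((Finset.univ.filter (fun x => ρ x = x)).map
          (e.toEmbedding.trans (Function.Embedding.subtype _))) := by
    ext x
    by_cases hx : x = j
    · subst hx
      simp [Equiv.Perm.ofSubtype_apply_of_not_mem]
    · obtain ⟨y, hy⟩ := e.surjective ⟨x, hx⟩
      obtain rfl : (e y : Fin (n + 1)) = x := by rw [hy]
      simp [Equiv.Perm.ofSubtype_apply_coe, hx, Subtype.val_injective.eq_iff]
  unfold fixedPointCount
  rw [hs, Finset.card_insert_of_notMem, Finset.card_map]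
  simp only [Finset.mem_map, not_exists, not_and]
  intro y _ hy
  exact (e y).2 hy

theorem numFixing_singleton {n : ℕ} (k : ℕ) (j : Fin (n + 1)) :
    numFixing (n + 1) (k + 1) {j} = numPermsWithFixed n k := by
  have e : Fin n ≃ {x // x ≠ j} := finSuccAboveEquiv j
  symm
  unfold numFixing numPermsWithFixed
  refine Finset.card_nbij (fun ρ => Equiv.Perm.ofSubtype (e.permCongr ρ)) ?_ ?_ ?_
  · intro ρ hρ
    simp only [Finset.mem_coe, mem_permsWithFixed] at hρ
    simp only [Finset.coe_filter, Set.mem_ofPred_eq, mem_permsWithFixed, Finset.mem_singleton,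
      forall_eq]
    exact ⟨by rw [fixedPointCount_subtypePerm, hρ],
      Equiv.Perm.ofSubtype_apply_of_not_mem _ (by simp)⟩
  · intro a _ b _ hab
    exact e.permCongr.injective (Equiv.Perm.ofSubtype_injective hab)
  · intro τ hτ
    simp only [Finset.coe_filter, Set.mem_ofPred_eq, mem_permsWithFixed, Finset.mem_singleton,
      forall_eq] at hτ
    have hp : ∀ x, τ x ≠ j ↔ x ≠ j := fun x => by
      conv_lhs => rw [← hτ.2]
      exact τ.injective.ne_iff
    have hτ' : Equiv.Perm.ofSubtype (e.permCongr (e.permCongr.symm (τ.subtypePerm hp))) = τ := by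
      rw [Equiv.apply_symm_apply]
      refine Equiv.Perm.ofSubtype_subtypePerm hp fun x hx => ?_
      rintro rfl
      exact hx hτ.2
    refine ⟨e.permCongr.symm (τ.subtypePerm hp), ?_, hτ'⟩
    have := fixedPointCount_subtypePerm j e (e.permCongr.symm (τ.subtypePerm hp))
    rw [hτ', hτ.1] at this
    rw [Finset.mem_coe, mem_permsWithFixed]
    omega

theorem fixedPointCount_mul_swap {n : ℕ} {τ : Equiv.Perm (Fin n)} {a b : Fin n} (hab : a ≠ b)
    (ha : τ a = a) (hb : τ b = b) :
    fixedPointCount τ = fixedPointCount (τ * Equiv.swap a b) + 2 := by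
  have hs : Finset.univ.filter (fun x => τ x = x)
      = insert a (insert b (Finset.univ.filter (fun x => (τ * Equiv.swap a b) x = x))) := by
    ext x
    by_cases hxa : x = a
    · simp [hxa, ha]
    by_cases hxb : x = b
    · simp [hxb, hb]
    rw [Finset.mem_insert, Finset.mem_insert, Finset.mem_filter, Finset.mem_filter,
      Equiv.Perm.mul_apply, Equiv.swap_apply_of_ne_of_ne hxa hxb]
    simp [hxa, hxb]
  unfold fixedPointCount
  rw [hs, Finset.card_insert_of_notMem, Finset.card_insert_of_notMem]
  · rw [Finset.mem_filter]
    simp [ha, hab]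
  · rw [Finset.mem_insert, Finset.mem_filter]
    simp [hb, hab, hab.symm]

/-- Removing the 2-cycle containing `j` from a permutation. -/
theorem card_twoCycle_eq {n : ℕ} (k : ℕ) {i j : Fin n} (hij : i < j) :
    ((permsWithFixed n k).filter
      (fun σ => σ j ≠ j ∧ σ (σ j) = j ∧ σ⁻¹ i < σ⁻¹ j)).card =
    ((Finset.univ ×ˢ permsWithFixed n (k + 2)).filter
      (fun p : Fin n × Equiv.Perm (Fin n) =>
        p.1 ≠ i ∧ p.1 ≠ j ∧ p.2 j = j ∧ p.2 p.1 = p.1 ∧ p.2⁻¹ i < p.1)).card := by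
  refine Finset.card_nbij' (fun σ => (σ j, σ * Equiv.swap j (σ j)))
    (fun p => p.2 * Equiv.swap j p.1) ?_ ?_ ?_ ?_
  · intro σ hσ
    simp only [Finset.coe_filter, Set.mem_ofPred_eq, mem_permsWithFixed, Finset.mem_product,
      Finset.mem_univ, true_and] at hσ ⊢
    obtain ⟨hk, h1, h2, h3⟩ := hσ
    have hinv : σ⁻¹ j = σ j := by rw [Equiv.Perm.inv_eq_iff_eq, h2]
    have hi : σ j ≠ i := by
      intro h
      rw [hinv, h, Equiv.Perm.inv_eq_iff_eq.2 h.symm] at h3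
      exact absurd h3 hij.asymm
    have e1 : (σ * Equiv.swap j (σ j)) j = j := by simp [h2]
    have e2 : (σ * Equiv.swap j (σ j)) (σ j) = σ j := by simp
    refine ⟨?_, hi, h1, e1, e2, ?_⟩
    · rw [fixedPointCount_mul_swap h1.symm e1 e2, mul_assoc, Equiv.swap_mul_self, mul_one, hk]
    · rw [mul_inv_rev, Equiv.swap_inv, Equiv.Perm.mul_apply, Equiv.swap_apply_of_ne_of_ne]
      · rwa [hinv] at h3
      · rw [Ne, Equiv.Perm.inv_eq_iff_eq]
        exact hi.symm
      · rw [Ne, Equiv.Perm.inv_eq_iff_eq, h2]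
        exact hij.ne
  · rintro ⟨m, τ⟩ hτ
    simp only [Finset.coe_filter, Set.mem_ofPred_eq, mem_permsWithFixed, Finset.mem_product,
      Finset.mem_univ, true_and] at hτ ⊢
    obtain ⟨hk, h1, h2, h3, h4, h5⟩ := hτ
    have e1 : (τ * Equiv.swap j m) j = m := by simp [h4]
    have e2 : (τ * Equiv.swap j m) m = j := by simp [h3]
    refine ⟨?_, by rwa [e1], by rw [e1, e2], ?_⟩
    · have := fixedPointCount_mul_swap h2.symm h3 h4
      omega
    · have hinv : (τ * Equiv.swap j m)⁻¹ j = m := by rw [Equiv.Perm.inv_eq_iff_eq, e2]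
      rw [hinv, mul_inv_rev, Equiv.swap_inv, Equiv.Perm.mul_apply, Equiv.swap_apply_of_ne_of_ne]
      · exact h5
      · rw [Ne, Equiv.Perm.inv_eq_iff_eq, h3]
        exact hij.ne
      · rw [Ne, Equiv.Perm.inv_eq_iff_eq, h4]
        exact h1.symm
  · intro σ _
    simp [mul_assoc]
  · rintro ⟨m, τ⟩ hτ
    simp only [Finset.coe_filter, Set.mem_ofPred_eq] at hτ
    simp [hτ.2.2.2.2.1, mul_assoc]

theorem card_filter_prod_permsWithFixed {n : ℕ} (k : ℕ) (P : Fin n → Equiv.Perm (Fin n) → Prop)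
    [∀ m τ, Decidable (P m τ)] :
    ((Finset.univ ×ˢ permsWithFixed n k).filter
      (fun p : Fin n × Equiv.Perm (Fin n) => P p.1 p.2)).card =
    ∑ m, ((permsWithFixed n k).filter (P m)).card := by
  simp only [Finset.card_filter, Finset.sum_product]

theorem card_fixed_part {n : ℕ} (k : ℕ) {i j : Fin n} (hij : i < j) (c : ℕ)
    (hc : ∀ m, m ∉ ({i, j} : Finset (Fin n)) → numFixing n k (insert m {i, j}) = c) :
    (((Finset.univ ×ˢ permsWithFixed n k).filter
      (fun p : Fin n × Equiv.Perm (Fin n) =>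
        (p.1 ≠ i ∧ p.1 ≠ j ∧ p.2 j = j ∧ p.2 p.1 = p.1 ∧ p.2⁻¹ i < p.1) ∧ p.2 i = i)).card : ℤ) =
    ((n : ℤ) - i - 2) * c := by
  rw [card_filter_prod_permsWithFixed k (fun m τ =>
    (m ≠ i ∧ m ≠ j ∧ τ j = j ∧ τ m = m ∧ τ⁻¹ i < m) ∧ τ i = i)]
  have h : ∀ m, ((permsWithFixed n k).filter (fun τ =>
      (m ≠ i ∧ m ≠ j ∧ τ j = j ∧ τ m = m ∧ τ⁻¹ i < m) ∧ τ i = i)).card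
      = if m ∈ (Finset.Ioi i).erase j then c else 0 := by
    intro m
    split_ifs with hm
    · rw [Finset.mem_erase, Finset.mem_Ioi] at hm
      rw [← hc m (by simp [hm.1, hm.2.ne'])]
      unfold numFixing
      congr 1
      refine Finset.filter_congr fun τ _ => ?_
      simp only [Finset.mem_insert, Finset.mem_singleton, forall_eq_or_imp, forall_eq]
      constructor
      · tauto
      · rintro ⟨h1, h2, h3⟩
        refine ⟨⟨hm.2.ne', hm.1, h3, h1, ?_⟩, h2⟩
        rw [Equiv.Perm.inv_eq_iff_eq.2 h2.symm]
        exact hm.2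
    · rw [Finset.card_eq_zero, Finset.filter_eq_empty_iff]
      rintro τ _ ⟨⟨_, h2, _, _, h5⟩, h6⟩
      rw [Equiv.Perm.inv_eq_iff_eq.2 h6.symm] at h5
      exact hm (by simp [h2, h5])
  rw [Finset.sum_congr rfl (fun m _ => h m), Finset.sum_ite_mem, Finset.univ_inter,
    Finset.sum_const, Finset.card_erase_of_mem (by simpa using hij), Fin.card_Ioi, smul_eq_mul]
  have := i.2
  have : (i : ℕ) < j := hij
  have := j.2
  push_cast
  congr 1
  omega

theorem two_mul_card_nonfixed_part {n : ℕ} (k : ℕ) {i j : Fin n} (hij : i ≠ j) (b c : ℕ)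
    (hb : ∀ m, m ∉ ({j} : Finset (Fin n)) → numFixing n k (insert m {j}) = b)
    (hc : ∀ m, m ∉ ({i, j} : Finset (Fin n)) → numFixing n k (insert m {i, j}) = c) :
    2 * (((Finset.univ ×ˢ permsWithFixed n k).filter
      (fun p : Fin n × Equiv.Perm (Fin n) =>
        (p.1 ≠ i ∧ p.1 ≠ j ∧ p.2 j = j ∧ p.2 p.1 = p.1 ∧ p.2⁻¹ i < p.1) ∧ p.2 i ≠ i)).card : ℤ) =
    ((n : ℤ) - 2) * ((b : ℤ) - c) := by
  set Y := (Finset.univ ×ˢ permsWithFixed n k).filter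
      (fun p : Fin n × Equiv.Perm (Fin n) =>
        p.1 ≠ i ∧ p.1 ≠ j ∧ p.2 j = j ∧ p.2 p.1 = p.1 ∧ p.2 i ≠ i) with hY
  have hlt : (Finset.univ ×ˢ permsWithFixed n k).filter
      (fun p : Fin n × Equiv.Perm (Fin n) =>
        (p.1 ≠ i ∧ p.1 ≠ j ∧ p.2 j = j ∧ p.2 p.1 = p.1 ∧ p.2⁻¹ i < p.1) ∧ p.2 i ≠ i) =
      Y.filter (fun p => p.2⁻¹ i < p.1) := by
    rw [hY, Finset.filter_filter]
    refine Finset.filter_congr fun p _ => ?_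
    tauto
  have hmem : ∀ p ∈ Y, ((p.2⁻¹ i, Equiv.swap (p.2⁻¹ i) p.1 * p.2 * (Equiv.swap (p.2⁻¹ i) p.1)⁻¹) :
      Fin n × Equiv.Perm (Fin n)) ∈ Y ∧
      (Equiv.swap (p.2⁻¹ i) p.1 * p.2 * (Equiv.swap (p.2⁻¹ i) p.1)⁻¹)⁻¹ i = p.1 := by
    rintro ⟨m, τ⟩ hp
    simp only [hY, Finset.mem_filter, mem_permsWithFixed, Finset.mem_product,
      Finset.mem_univ, true_and] at hp ⊢
    obtain ⟨hk, h1, h2, h3, h4, h5⟩ := hp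
    obtain ⟨q, hq⟩ : ∃ q, τ⁻¹ i = q := ⟨_, rfl⟩
    have hq' : τ q = i := by rw [← hq]; simp
    have hqi : q ≠ i := by rintro rfl; exact h5 hq'
    have hqj : q ≠ j := by rintro rfl; exact hij (hq'.symm.trans h3)
    have hsi : Equiv.swap q m i = i := Equiv.swap_apply_of_ne_of_ne hqi.symm h1.symm
    have hsj : Equiv.swap q m j = j := Equiv.swap_apply_of_ne_of_ne hqj.symm h2.symm
    have hm : (Equiv.swap q m * τ * (Equiv.swap q m)⁻¹) m = i := by
      simp [hq', hsi]
    rw [hq]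
    refine ⟨⟨by rw [fixedPointCount_conj, hk], hqi, hqj, ?_, ?_, ?_⟩, ?_⟩
    · simp [hsj, h3]
    · simp [h4]
    · intro h
      exact h1 ((Equiv.swap q m * τ * (Equiv.swap q m)⁻¹).injective (hm.trans h.symm))
    · rw [Equiv.Perm.inv_eq_iff_eq, hm]
  have hinv : ∀ p ∈ Y, Equiv.swap p.1 (p.2⁻¹ i) *
      (Equiv.swap (p.2⁻¹ i) p.1 * p.2 * (Equiv.swap (p.2⁻¹ i) p.1)⁻¹) *
      (Equiv.swap p.1 (p.2⁻¹ i))⁻¹ = p.2 := by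
    intro p _
    rw [Equiv.swap_comm p.1]
    simp only [Equiv.swap_inv, mul_assoc, Equiv.swap_mul_self, mul_one]
    rw [← mul_assoc, Equiv.swap_mul_self, one_mul]
  have hsymm : (Y.filter (fun p => p.2⁻¹ i < p.1)).card =
      (Y.filter (fun p => ¬ p.2⁻¹ i < p.1)).card := by
    refine Finset.card_nbij'
      (fun p => (p.2⁻¹ i, Equiv.swap (p.2⁻¹ i) p.1 * p.2 * (Equiv.swap (p.2⁻¹ i) p.1)⁻¹))
      (fun p => (p.2⁻¹ i, Equiv.swap (p.2⁻¹ i) p.1 * p.2 * (Equiv.swap (p.2⁻¹ i) p.1)⁻¹))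
      ?_ ?_ ?_ ?_
    · intro p hp
      rw [Finset.mem_coe, Finset.mem_filter] at hp ⊢
      refine ⟨(hmem p hp.1).1, ?_⟩
      rw [(hmem p hp.1).2]
      exact hp.2.asymm
    · intro p hp
      rw [Finset.mem_coe, Finset.mem_filter] at hp ⊢
      refine ⟨(hmem p hp.1).1, ?_⟩
      rw [(hmem p hp.1).2]
      refine lt_of_le_of_ne (not_lt.1 hp.2) fun h => ?_
      have hp1 := hp.1
      rw [hY, Finset.mem_filter] at hp1
      obtain ⟨_, h1, _, _, h4, _⟩ := hp1
      rw [eq_comm, Equiv.Perm.inv_eq_iff_eq, h4] at h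
      exact h1 h.symm
    · intro p hp
      rw [Finset.mem_coe, Finset.mem_filter] at hp
      exact Prod.ext (hmem p hp.1).2 (by
        simp only [(hmem p hp.1).2]
        exact hinv p hp.1)
    · intro p hp
      rw [Finset.mem_coe, Finset.mem_filter] at hp
      exact Prod.ext (hmem p hp.1).2 (by
        simp only [(hmem p hp.1).2]
        exact hinv p hp.1)
  have hsum := Finset.card_filter_add_card_filter_not (s := Y) (fun p => p.2⁻¹ i < p.1)
  have hcard : (Y.card : ℤ) = ((n : ℤ) - 2) * ((b : ℤ) - c) := by
    rw [hY, card_filter_prod_permsWithFixed k (fun m τ =>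
      m ≠ i ∧ m ≠ j ∧ τ j = j ∧ τ m = m ∧ τ i ≠ i)]
    have h : ∀ m, (((permsWithFixed n k).filter (fun τ =>
        m ≠ i ∧ m ≠ j ∧ τ j = j ∧ τ m = m ∧ τ i ≠ i)).card : ℤ)
        = if m ∈ ({i, j} : Finset (Fin n))ᶜ then (b : ℤ) - c else 0 := by
      intro m
      split_ifs with hm
      · rw [Finset.mem_compl] at hm
        have hm' : m ≠ i ∧ m ≠ j := by simpa using hm
        rw [← hc m hm, ← hb m (by simpa using hm'.2), eq_sub_iff_add_eq, ← Nat.cast_add,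
          Nat.cast_inj]
        unfold numFixing
        rw [← Finset.card_filter_add_card_filter_not (s := (permsWithFixed n k).filter
          (fun τ => ∀ x ∈ (insert m {j} : Finset (Fin n)), τ x = x)) (fun τ => τ i = i), add_comm,
          Finset.filter_filter, Finset.filter_filter]
        congr 2 <;>
        · refine Finset.filter_congr fun τ _ => ?_
          simp only [Finset.mem_insert, Finset.mem_singleton, forall_eq_or_imp, forall_eq]
          tauto
      · rw [Nat.cast_eq_zero, Finset.card_eq_zero, Finset.filter_eq_empty_iff]
        rintro τ _ ⟨h1, h2, _⟩
        exact hm (by simp [h1, h2])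
    have hn : 2 ≤ n := by
      have := i.2
      have := j.2
      have : (i : ℕ) ≠ j := fun h => hij (Fin.ext h)
      omega
    rw [Nat.cast_sum, Finset.sum_congr rfl (fun m _ => h m), Finset.sum_ite_mem,
      Finset.univ_inter, Finset.sum_const, Finset.card_compl, Finset.card_pair hij,
      Fintype.card_fin, nsmul_eq_mul, Nat.cast_sub hn]
    rfl
  rw [hlt, ← hcard, ← hsum, ← hsymm]
  push_cast
  ring

/-- The number of permutations of `{1,…,n}` with exactly `k` fixed points in which `j`
lies in a 2-cycle and `i` precedes `j` satisfies
`2(n-1)(n-2) · # = d_{n-1,k+1} · (k+1) · (2k(n-i-1) + (n-2)(n-2-k))`. -/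
theorem stmt17 (n k i j : ℕ) (hn : 3 ≤ n) (hk : k ≤ n - 2)
    (hi : 1 ≤ i) (hij : i < j) (hj : j ≤ n) :
    2 * ((n : ℤ) - 1) * ((n : ℤ) - 2) * (((permsWithFixed n k).filter
        (fun σ => σ (⟨j - 1, by omega⟩ : Fin n) ≠ (⟨j - 1, by omega⟩ : Fin n) ∧
          σ (σ (⟨j - 1, by omega⟩ : Fin n)) = (⟨j - 1, by omega⟩ : Fin n) ∧
          σ⁻¹ (⟨i - 1, by omega⟩ : Fin n) < σ⁻¹ (⟨j - 1, by omega⟩ : Fin n))).card : ℤ) =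
      (numPermsWithFixed (n - 1) (k + 1) : ℤ) * ((k : ℤ) + 1) *
        (2 * (k : ℤ) * ((n : ℤ) - (i : ℤ) - 1) + ((n : ℤ) - 2) * ((n : ℤ) - 2 - (k : ℤ))) := by
  obtain ⟨n, rfl⟩ : ∃ n', n = n' + 1 := ⟨n - 1, by omega⟩
  set i' : Fin (n + 1) := ⟨i - 1, by omega⟩ with hi'
  set j' : Fin (n + 1) := ⟨j - 1, by omega⟩ with hj'
  have hlt : i' < j' := by
    rw [hi', hj', Fin.mk_lt_mk]
    omega
  obtain ⟨m, hm⟩ : ∃ m, m ∉ ({i', j'} : Finset (Fin (n + 1))) := by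
    by_contra! h
    have h1 := Finset.card_le_card (fun x (_ : x ∈ Finset.univ) => h x)
    rw [Finset.card_pair hlt.ne, Finset.card_univ, Fintype.card_fin] at h1
    omega
  have hij' : i' ∉ ({j'} : Finset (Fin (n + 1))) := by simpa using hlt.ne
  have h1 := card_fixed_part (k + 2) hlt _ (fun x hx => numFixing_insert_eq (k + 2) hx hm)
  have h2 := two_mul_card_nonfixed_part (k + 2) hlt.ne _ _
    (fun x hx => numFixing_insert_eq (k + 2) hx hij')
    (fun x hx => numFixing_insert_eq (k + 2) hx hm)
  have h3 := card_compl_mul_numFixing_insert (k + 2) hm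
  have h4 := card_compl_mul_numFixing_insert (k + 2) hij'
  rw [Finset.card_pair hlt.ne] at h3
  rw [Finset.card_singleton, numFixing_singleton] at h4
  have hi0 : ((i' : ℕ) : ℤ) = (i : ℤ) - 1 := by
    simp only [hi']
    omega
  rw [card_twoCycle_eq k hlt, ← Finset.card_filter_add_card_filter_not
    (fun p : Fin (n + 1) × Equiv.Perm (Fin (n + 1)) => p.2 i' = i'),
    Finset.filter_filter, Finset.filter_filter, Nat.cast_add, Nat.add_sub_cancel]
  rw [hi0] at h1
  push_cast at h1 h2 h3 h4 ⊢
  linear_combination 2 * (n : ℤ) * ((n : ℤ) - 1) * h1 + (n : ℤ) * ((n : ℤ) - 1) * h2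
    + (2 * (n : ℤ) * ((n : ℤ) - i) - (n : ℤ) * ((n : ℤ) - 1)) * h3
    + (2 * (k : ℤ) * ((n : ℤ) - i) + ((n : ℤ) - 1) * ((n : ℤ) - 1 - k)) * h4
end

section
/- For every integer n ≥ 3, the average number of inversions over all derangements of {1,…,n} differs from n(n−1)/4 + n/6 + 1/12 by a super-exponentially small amount: |(1/d_n)·∑_{σ ∈ D_n} I(σ) − n(n−1)/4 − n/6 − 1/12| ≤ 1/(n−1)!. -/
theorem mem_derangeSet {n : ℕ} {σ : Equiv.Perm (Fin n)} : σ ∈ derangeSet n ↔ ∀ x, σ x ≠ x := by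
  simp [derangeSet]

theorem numDerange_eq_numDerangements (n : ℕ) : numDerange n = numDerangements n := by
  rw [← card_derangements_fin_eq_numDerangements, numDerange, derangeSet,
    ← Fintype.card_subtype]
  exact Fintype.card_congr (Equiv.refl _)

/-- Conjugation by a permutation preserves the derangements. -/
theorem conj_mem_derangeSet {n : ℕ} (π : Equiv.Perm (Fin n)) {σ : Equiv.Perm (Fin n)}
    (h : σ ∈ derangeSet n) : π * σ * π⁻¹ ∈ derangeSet n := by
  rw [mem_derangeSet] at h ⊢
  intro x hx
  apply h (π⁻¹ x)
  rw [Equiv.Perm.mul_apply, Equiv.Perm.mul_apply] at hx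
  rw [Equiv.Perm.eq_inv_iff_eq, hx]

/-- The number of derangements mapping `a` to `b`. -/
def derangeCountStep {n : ℕ} (a b : Fin n) : ℕ :=
  ((derangeSet n).filter (fun σ => σ a = b)).card

/-- The number of derangements mapping `a` to `b` and `b` to `c`. -/
def derangeCountPath {n : ℕ} (a b c : Fin n) : ℕ :=
  ((derangeSet n).filter (fun σ => σ a = b ∧ σ b = c)).card

theorem derangeCountStep_le_map {n : ℕ} (π : Equiv.Perm (Fin n)) (a b : Fin n) :
    derangeCountStep a b ≤ derangeCountStep (π a) (π b) := by
  apply Finset.card_le_card_of_injOn (fun σ => π * σ * π⁻¹)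
  · intro σ hσ
    simp only [Finset.coe_filter, Set.mem_ofPred_eq] at hσ ⊢
    exact ⟨conj_mem_derangeSet π hσ.1, by simp [hσ.2]⟩
  · intro σ _ τ _ h
    simpa using h

theorem derangeCountPath_le_map {n : ℕ} (π : Equiv.Perm (Fin n)) (a b c : Fin n) :
    derangeCountPath a b c ≤ derangeCountPath (π a) (π b) (π c) := by
  apply Finset.card_le_card_of_injOn (fun σ => π * σ * π⁻¹)
  · intro σ hσ
    simp only [Finset.coe_filter, Set.mem_ofPred_eq] at hσ ⊢
    exact ⟨conj_mem_derangeSet π hσ.1, by simp [hσ.2.1, hσ.2.2]⟩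
  · intro σ _ τ _ h
    simpa using h

theorem derangeCountStep_eq_of_ne {n : ℕ} {a b b' : Fin n} (hb : b ≠ a) (hb' : b' ≠ a) :
    derangeCountStep a b = derangeCountStep a b' := by
  apply le_antisymm
  · simpa [Equiv.swap_apply_of_ne_of_ne hb.symm hb'.symm] using
      derangeCountStep_le_map (Equiv.swap b b') a b
  · simpa [Equiv.swap_apply_of_ne_of_ne hb.symm hb'.symm] using
      derangeCountStep_le_map (Equiv.swap b b') a b'

theorem derangeCountPath_eq_of_ne {n : ℕ} {a b c c' : Fin n} (hca : c ≠ a) (hcb : c ≠ b)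
    (hca' : c' ≠ a) (hcb' : c' ≠ b) : derangeCountPath a b c = derangeCountPath a b c' := by
  apply le_antisymm
  · simpa [Equiv.swap_apply_of_ne_of_ne hca.symm hca'.symm,
      Equiv.swap_apply_of_ne_of_ne hcb.symm hcb'.symm] using
      derangeCountPath_le_map (Equiv.swap c c') a b c
  · simpa [Equiv.swap_apply_of_ne_of_ne hca.symm hca'.symm,
      Equiv.swap_apply_of_ne_of_ne hcb.symm hcb'.symm] using
      derangeCountPath_le_map (Equiv.swap c c') a b c'

theorem derangeCountStep_self {n : ℕ} (a : Fin n) : derangeCountStep a a = 0 := by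
  rw [derangeCountStep, Finset.card_eq_zero, Finset.filter_eq_empty_iff]
  intro σ hσ
  exact mem_derangeSet.1 hσ a

theorem derangeCountPath_self {n : ℕ} (a b : Fin n) : derangeCountPath a b b = 0 := by
  rw [derangeCountPath, Finset.card_eq_zero, Finset.filter_eq_empty_iff]
  intro σ hσ h
  exact mem_derangeSet.1 hσ b h.2

theorem sum_derangeCountStep {n : ℕ} (a : Fin n) :
    ∑ b, derangeCountStep a b = numDerange n := by
  rw [numDerange, Finset.card_eq_sum_card_fiberwise (f := fun σ => σ a) (t := Finset.univ)
    (by simp)]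
  rfl

theorem sum_derangeCountPath {n : ℕ} (a b : Fin n) :
    ∑ c, derangeCountPath a b c = derangeCountStep a b := by
  rw [derangeCountStep, Finset.card_eq_sum_card_fiberwise (f := fun σ => σ b) (t := Finset.univ)
    (by simp)]
  simp only [Finset.filter_filter]
  rfl

theorem derangeCountStep_eq {m : ℕ} {a b : Fin (m + 2)} (h : b ≠ a) :
    derangeCountStep a b = numDerangements m + numDerangements (m + 1) := by
  have h1 := sum_derangeCountStep a
  rw [← Finset.add_sum_erase _ _ (Finset.mem_univ a), derangeCountStep_self, zero_add,
    Finset.sum_congr rfl (fun c hc => derangeCountStep_eq_of_ne (Finset.ne_of_mem_erase hc) h),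
    Finset.sum_const, Finset.card_erase_of_mem (Finset.mem_univ a), Finset.card_univ,
    Fintype.card_fin, numDerange_eq_numDerangements, numDerangements_add_two, smul_eq_mul] at h1
  exact Nat.eq_of_mul_eq_mul_left (Nat.succ_pos m) h1

/-- Derangements interchanging two given points are derangements of the other points. -/
theorem derangeCountPath_eq_numDerangements {m : ℕ} {a b : Fin (m + 2)} (h : a ≠ b) :
    derangeCountPath a b a = numDerangements m := by
  have e := Fintype.card_congr
    (derangements.subtypeEquiv (fun x : Fin (m + 2) => x ∉ ({a, b} : Finset (Fin (m + 2)))))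
  rw [card_derangements_eq_numDerangements] at e
  have hc : Fintype.card {x : Fin (m + 2) // x ∉ ({a, b} : Finset (Fin (m + 2)))} = m := by
    rw [Fintype.card_subtype, Finset.filter_notMem_eq_sdiff, Finset.card_univ_sdiff,
      Finset.card_pair h, Fintype.card_fin, Nat.add_sub_cancel]
  rw [hc, Fintype.card_subtype] at e
  rw [e, derangeCountPath]
  apply Finset.card_bij' (fun σ _ => Equiv.swap a b * σ) (fun σ _ => Equiv.swap a b * σ)
  · intro σ hσ
    simp only [Finset.mem_filter, mem_derangeSet, Finset.mem_univ, true_and] at hσ ⊢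
    obtain ⟨hd, hab, hba⟩ := hσ
    intro x
    rw [not_not, Function.mem_fixedPoints, Function.IsFixedPt, Equiv.Perm.mul_apply]
    have h1 := hd x
    have h2 : σ x = b ↔ x = a := by rw [← hab]; exact σ.injective.eq_iff
    have h3 : σ x = a ↔ x = b := by rw [← hba]; exact σ.injective.eq_iff
    simp only [Finset.mem_insert, Finset.mem_singleton, Equiv.swap_apply_def]
    grind
  · intro σ hσ
    simp only [Finset.mem_filter, mem_derangeSet, Finset.mem_univ, true_and, not_not,
      Function.mem_fixedPoints, Function.IsFixedPt, Finset.mem_insert,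
      Finset.mem_singleton] at hσ ⊢
    have ha : σ a = a := (hσ a).1 (Or.inl rfl)
    have hb : σ b = b := (hσ b).1 (Or.inr rfl)
    refine ⟨fun x => ?_, by simp [ha], by simp [hb]⟩
    have h1 := hσ x
    have h2 : σ x = a ↔ x = a := by conv_lhs => rw [← ha, σ.injective.eq_iff]
    have h3 : σ x = b ↔ x = b := by conv_lhs => rw [← hb, σ.injective.eq_iff]
    simp only [Equiv.Perm.mul_apply, Equiv.swap_apply_def]
    grind
  · intro σ _
    simp [← mul_assoc]
  · intro σ _
    simp [← mul_assoc]

theorem mul_derangeCountPath {m : ℕ} {a b c : Fin (m + 2)} (h : a ≠ b) (hca : c ≠ a)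
    (hcb : c ≠ b) : m * derangeCountPath a b c = numDerangements (m + 1) := by
  have h1 := sum_derangeCountPath a b
  have hb : b ∈ Finset.univ.erase a := by simp [h.symm]
  rw [← Finset.add_sum_erase _ _ (Finset.mem_univ a), ← Finset.add_sum_erase _ _ hb,
    derangeCountPath_self, zero_add, derangeCountPath_eq_numDerangements h,
    derangeCountStep_eq h.symm,
    Finset.sum_congr rfl (fun d hd => derangeCountPath_eq_of_ne (a := a) (b := b)
      (Finset.ne_of_mem_erase (Finset.mem_of_mem_erase hd)) (Finset.ne_of_mem_erase hd) hca hcb),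
    Finset.sum_const, Finset.card_erase_of_mem hb,
    Finset.card_erase_of_mem (Finset.mem_univ a), Finset.card_univ, Fintype.card_fin,
    smul_eq_mul] at h1
  exact Nat.add_left_cancel h1

/-- `1` if `y < x` and `-1` otherwise. -/
def descentSign {n : ℕ} (x y : Fin n) : ℤ := if y < x then 1 else -1

/-- Derangements avoiding `a ↦ b` and `b ↦ a` cancel in pairs under precomposition
with the transposition of `a` and `b`. -/
theorem sum_descentSign_avoiding {n : ℕ} {a b : Fin n} (h : a ≠ b) :
    ∑ σ ∈ (derangeSet n).filter (fun σ => σ a ≠ b ∧ σ b ≠ a), descentSign (σ a) (σ b) = 0 := by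
  apply Finset.sum_involution (fun σ _ => σ * Equiv.swap a b)
  · intro σ _
    have hne : σ a ≠ σ b := fun e => h (σ.injective e)
    simp only [descentSign, Equiv.Perm.mul_apply, Equiv.swap_apply_left, Equiv.swap_apply_right]
    rcases lt_or_gt_of_ne hne with hl | hl <;> simp [hl, hl.not_gt]
  · intro σ _ _ he
    apply h
    have : Equiv.swap a b = 1 := by simpa using he
    exact Equiv.swap_eq_one_iff.1 this
  · intro σ hσ
    simp only [Finset.mem_filter, mem_derangeSet] at hσ ⊢
    obtain ⟨hd, hab, hba⟩ := hσ
    have ha := hd a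
    have hb := hd b
    refine ⟨fun x => ?_, by simpa using hb, by simpa using ha⟩
    have hx := hd x
    simp only [Equiv.Perm.mul_apply, Equiv.swap_apply_def]
    grind
  · intro σ _
    simp [mul_assoc]

theorem sum_descentSign_eq_paths {n : ℕ} {a b : Fin n} (h : a < b) :
    ∑ σ ∈ derangeSet n, descentSign (σ a) (σ b) =
      derangeCountPath a b a +
        ∑ c ∈ (Finset.univ.erase a).erase b,
          ((derangeCountPath a b c : ℤ) * descentSign b c
            + (derangeCountPath b a c : ℤ) * descentSign c a) := by
  have key : ∀ σ ∈ derangeSet n, descentSign (σ a) (σ b) =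
      (if σ a ≠ b ∧ σ b ≠ a then descentSign (σ a) (σ b) else 0) +
      ((if σ a = b ∧ σ b = a then 1 else 0) +
        ∑ c ∈ (Finset.univ.erase a).erase b,
          ((if σ a = b ∧ σ b = c then 1 else 0) * descentSign b c
            + (if σ b = a ∧ σ a = c then 1 else 0) * descentSign c a)) := by
    intro σ hσ
    have hd := mem_derangeSet.1 hσ
    have ha := hd a
    have hb := hd b
    by_cases h1 : σ a = b <;> by_cases h2 : σ b = a
    · have h3 : ∀ c ∈ (Finset.univ.erase a).erase b, a ≠ c ∧ b ≠ c := by simp; grind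
      rw [Finset.sum_eq_zero]
      · simp [h1, h2, descentSign, h]
      · intro c hc
        simp [h1, h2, h3 c hc]
    · simp [h1, h2, Finset.sum_ite_eq, hb]
    · simp [h1, h2, Finset.sum_ite_eq, ha]
    · simp [h1, h2]
  rw [Finset.sum_congr rfl key, Finset.sum_add_distrib, ← Finset.sum_filter,
    sum_descentSign_avoiding h.ne, zero_add, Finset.sum_add_distrib, Finset.sum_comm]
  congr 1
  · simp [derangeCountPath]
  · refine Finset.sum_congr rfl fun c _ => ?_
    rw [Finset.sum_add_distrib, ← Finset.sum_mul, ← Finset.sum_mul]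
    simp [derangeCountPath]

theorem mul_sum_descentSign {m : ℕ} {a b : Fin (m + 2)} (h : a < b) :
    (m : ℤ) * ∑ σ ∈ derangeSet (m + 2), descentSign (σ a) (σ b) =
      m * numDerangements m + 2 * numDerangements (m + 1) * ((b : ℤ) - a - 1) := by
  rw [sum_descentSign_eq_paths h, derangeCountPath_eq_numDerangements h.ne, mul_add,
    Finset.mul_sum]
  congr 1
  have key : ∀ c ∈ (Finset.univ.erase a).erase b,
      (m : ℤ) * ((derangeCountPath a b c : ℤ) * descentSign b c
            + (derangeCountPath b a c : ℤ) * descentSign c a) =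
      if c ∈ Finset.Ioo a b then 2 * (numDerangements (m + 1) : ℤ) else 0 := by
    intro c hc
    have hcb := Finset.ne_of_mem_erase hc
    have hca := Finset.ne_of_mem_erase (Finset.mem_of_mem_erase hc)
    have e1 : (m : ℤ) * derangeCountPath a b c = numDerangements (m + 1) :=
      mod_cast mul_derangeCountPath h.ne hca hcb
    have e2 : (m : ℤ) * derangeCountPath b a c = numDerangements (m + 1) :=
      mod_cast mul_derangeCountPath h.ne' hcb hca
    rw [mul_add, ← mul_assoc, ← mul_assoc, e1, e2]
    simp only [descentSign, Finset.mem_Ioo]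
    grind
  rw [Finset.sum_congr rfl key, ← Finset.sum_filter, Finset.sum_const]
  have hs : ((Finset.univ.erase a).erase b).filter (fun c => c ∈ Finset.Ioo a b) =
      Finset.Ioo a b := by
    ext c
    simp
    grind
  have hab : (a : ℕ) + 1 ≤ b := h
  rw [hs, Fin.card_Ioo, nsmul_eq_mul, Nat.sub_sub, Nat.cast_sub hab]
  push_cast
  ring

theorem two_mul_inversions {n : ℕ} (σ : Equiv.Perm (Fin n)) :
    2 * (inversions σ : ℤ) =
      ∑ b : Fin n, ∑ a ∈ Finset.Iio b, (descentSign (σ a) (σ b) + 1) := by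
  rw [inversions, Finset.card_filter, Fintype.sum_prod_type_right]
  push_cast
  rw [Finset.mul_sum]
  refine Finset.sum_congr rfl fun b _ => ?_
  have hI : Finset.Iio b = Finset.univ.filter (fun a => a < b) := by
    ext a; simp
  rw [hI, Finset.sum_filter, Finset.mul_sum]
  refine Finset.sum_congr rfl fun a _ => ?_
  simp only [descentSign]
  grind

theorem sum_Iio_val {n : ℕ} (f : ℕ → ℤ) (b : Fin n) :
    ∑ a ∈ Finset.Iio b, f a = ∑ a ∈ Finset.range b, f a := by
  rw [← Nat.Iio_eq_range, ← Fin.map_valEmbedding_Iio, Finset.sum_map]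
  rfl

theorem two_mul_sum_range_sub (b : ℕ) :
    2 * ∑ a ∈ Finset.range b, ((b : ℤ) - a - 1) = b * (b - 1) := by
  rw [Finset.sum_sub_distrib, Finset.sum_sub_distrib, mul_sub, mul_sub]
  have : 2 * ∑ a ∈ Finset.range b, (a : ℤ) = b * (b - 1) := by
    induction b with
    | zero => simp
    | succ b ih => rw [Finset.sum_range_succ, mul_add, ih]; push_cast; ring
  rw [this]
  simp
  ring

theorem two_mul_sum_pairs (n : ℕ) :
    2 * ∑ b : Fin n, ∑ _a ∈ Finset.Iio b, (1 : ℤ) = n * (n - 1) := by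
  simp only [Finset.sum_const, Fin.card_Iio, nsmul_eq_mul, mul_one]
  rw [Fin.sum_univ_eq_sum_range (fun b => (b : ℤ))]
  induction n with
  | zero => simp
  | succ b ih => rw [Finset.sum_range_succ, mul_add, ih]; push_cast; ring

theorem six_mul_sum_gaps (n : ℕ) :
    6 * ∑ b : Fin n, ∑ a ∈ Finset.Iio b, ((b : ℤ) - a - 1) = n * (n - 1) * (n - 2) := by
  have e : ∀ b : Fin n, 2 * ∑ a ∈ Finset.Iio b, ((b : ℤ) - a - 1) = (b : ℤ) * (b - 1) := by
    intro b
    rw [sum_Iio_val (fun a => (b : ℤ) - a - 1), two_mul_sum_range_sub]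
  rw [show (6 : ℤ) = 3 * 2 by norm_num, mul_assoc, Finset.mul_sum,
    Finset.sum_congr rfl fun b _ => e b,
    Fin.sum_univ_eq_sum_range (fun b => (b : ℤ) * (b - 1))]
  clear e
  induction n with
  | zero => simp
  | succ b ih => rw [Finset.sum_range_succ, mul_add, ih]; push_cast; ring

theorem twelve_mul_sum_inversions {m : ℕ} (hm : 1 ≤ m) :
    12 * ∑ σ ∈ derangeSet (m + 2), (inversions σ : ℤ) =
      ((m : ℤ) + 2) * (m + 1) * (3 * numDerangements m + 2 * numDerangements (m + 1)
        + 3 * numDerangements (m + 2)) := by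
  have hm0 : (m : ℤ) ≠ 0 := by positivity
  apply mul_left_cancel₀ hm0
  have h1 : (m : ℤ) * (2 * ∑ σ ∈ derangeSet (m + 2), (inversions σ : ℤ)) =
      ∑ b : Fin (m + 2), ∑ a ∈ Finset.Iio b,
        ((m : ℤ) * (numDerangements m + numDerangements (m + 2)) * 1 +
          2 * numDerangements (m + 1) * ((b : ℤ) - a - 1)) := by
    rw [Finset.mul_sum, Finset.sum_congr rfl fun σ _ => two_mul_inversions σ, Finset.sum_comm,
      Finset.mul_sum]
    refine Finset.sum_congr rfl fun b _ => ?_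
    rw [Finset.sum_comm, Finset.mul_sum]
    refine Finset.sum_congr rfl fun a ha => ?_
    rw [Finset.sum_add_distrib, mul_add, mul_sum_descentSign (Finset.mem_Iio.1 ha),
      Finset.sum_const, ← numDerange, numDerange_eq_numDerangements, nsmul_eq_mul]
    ring
  simp only [Finset.sum_add_distrib, ← Finset.mul_sum] at h1
  have h2 := two_mul_sum_pairs (m + 2)
  have h3 := six_mul_sum_gaps (m + 2)
  push_cast at h2 h3
  linear_combination 6 * h1 + 3 * (m : ℤ) * (numDerangements m + numDerangements (m + 2)) * h2 +
    2 * (numDerangements (m + 1) : ℤ) * h3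

theorem factorial_le_mul_numDerangements (n : ℕ) :
    (n + 2).factorial ≤ 12 * numDerangements (n + 2) := by
  induction n using Nat.twoStepInduction with
  | zero => decide
  | one => decide
  | more n ih1 ih2 =>
    rw [numDerangements_add_two (n + 2)]
    rw [Nat.factorial_succ (n + 2 + 1), Nat.factorial_succ (n + 2)]
    rw [Nat.factorial_succ (n + 2)] at ih2
    nlinarith

/-- The average number of inversions over all derangements of `{1,…,n}` differs from
`n(n-1)/4 + n/6 + 1/12` by at most `1/(n-1)!`. -/
theorem stmt19 (n : ℕ) (hn : 3 ≤ n) :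
    |((numDerange n : ℝ))⁻¹ * ∑ σ ∈ derangeSet n, (inversions σ : ℝ) -
        (n : ℝ) * ((n : ℝ) - 1) / 4 - (n : ℝ) / 6 - 1 / 12| ≤
      1 / (Nat.factorial (n - 1) : ℝ) := by
  obtain ⟨m, rfl⟩ : ∃ m, n = m + 2 := ⟨n - 2, by omega⟩
  have hsum : 12 * ∑ σ ∈ derangeSet (m + 2), (inversions σ : ℝ) =
      ((m : ℝ) + 2) * (m + 1) * (3 * numDerangements m + 2 * numDerangements (m + 1)
        + 3 * numDerangements (m + 2)) :=
    mod_cast twelve_mul_sum_inversions (m := m) (by omega)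
  have hrec : (numDerangements (m + 2) : ℝ) =
      (m + 1) * (numDerangements m + numDerangements (m + 1)) :=
    mod_cast numDerangements_add_two m
  have hsucc : (numDerangements (m + 2) : ℝ) =
      ((m : ℝ) + 2) * numDerangements (m + 1) - (-1) ^ (m + 1) := by
    have := numDerangements_succ (m + 1)
    have h : ((numDerangements (m + 2) : ℤ) : ℝ) =
      (((m + 1 : ℕ) + 1) * (numDerangements (m + 1) : ℤ) - (-1) ^ (m + 1) : ℤ) := by rw [this]
    push_cast at h
    linear_combination h
  have hfac : ((m + 2).factorial : ℝ) ≤ 12 * numDerangements (m + 2) :=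
    mod_cast factorial_le_mul_numDerangements m
  have hfpos : (0 : ℝ) < (m + 1).factorial := mod_cast Nat.factorial_pos _
  have hpos : (0 : ℝ) < numDerangements (m + 2) := by
    have : (0 : ℝ) < (m + 2).factorial := mod_cast Nat.factorial_pos _
    linarith
  rw [Nat.factorial_succ (m + 1)] at hfac
  push_cast at hfac
  have herr : ((numDerange (m + 2) : ℝ))⁻¹ * ∑ σ ∈ derangeSet (m + 2), (inversions σ : ℝ) -
        ((m + 2 : ℕ) : ℝ) * (((m + 2 : ℕ) : ℝ) - 1) / 4 - ((m + 2 : ℕ) : ℝ) / 6 - 1 / 12 =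
      (-1) ^ m * ((m + 1) / (12 * numDerangements (m + 2))) := by
    rw [numDerange_eq_numDerangements]
    push_cast
    field_simp
    rw [pow_succ] at hsucc
    linear_combination 24 * (hsum - 3 * ((m : ℝ) + 2) * hrec + ((m : ℝ) + 1) * hsucc)
  rw [herr, abs_mul, abs_pow, abs_neg, abs_one, one_pow, one_mul, abs_of_nonneg (by positivity),
    show m + 2 - 1 = m + 1 from rfl, div_le_div_iff₀ (by positivity) hfpos]
  nlinarith
end
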